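/- Let A be a C*-algebra and let (a_n) be a rapidly increasing sequence of positive contractions in A. Then there exists a sequence (m_n) of natural numbers such that, setting c_n = g_{2^{−(m_n+1)}, 2^{−m_n}}(a_n) (continuous functional calculus), the sequence (c_n) is very rapidly increasing and satisfies c_n ≾ a_n for every n and a_{n−1} ≾ c_n for every n ≥ 2. -/

import Mathlib

open Filter Topology

variable {A : Type*} [NonUnitalCStarAlgebra A] [PartialOrder A] [StarOrderedRing A]

/-- Cuntz subequivalence `a ≾ b` in a C*-algebra: there is a sequence `(vₙ)` in `A`
with `‖vₙ b vₙ* − a‖ → 0`. -/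
def CuntzBelow (a b : A) : Prop :=
  ∃ v : ℕ → A, Tendsto (fun n => ‖v n * b * star (v n) - a‖) atTop (𝓝 0)

/-- `(a − ε)₊`, the result of applying `t ↦ max (t − ε) 0` to `a` by the
continuous functional calculus. -/
noncomputable def cutP (a : A) (ε : ℝ) : A := cfcₙ (fun t : ℝ => max (t - ε) 0) a

/-- A sequence of positive contractions is rapidly increasing if for each `n` there is
`ε > 0` with `aₙ ≾ (a_{n+1} − ε)₊`. -/
def RapidlyIncreasing (a : ℕ → A) : Prop :=
  ∀ n, ∃ ε > (0 : ℝ), CuntzBelow (a n) (cutP (a (n + 1)) ε)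

/-- A sequence of positive contractions is very rapidly increasing if it is rapidly increasing
and for every `ε > 0` and every `n` there is `m₀` such that for all `m ≥ m₀` there is a
contraction `v` with `‖(v aₘ v*) aₙ − aₙ‖ < ε`. -/
def VeryRapidlyIncreasing (a : ℕ → A) : Prop :=
  RapidlyIncreasing a ∧
    ∀ ε > (0 : ℝ), ∀ n, ∃ m₀, ∀ m ≥ m₀,
      ∃ v : A, ‖v‖ ≤ 1 ∧ ‖v * a m * star v * a n - a n‖ < ε

/-- The continuous piecewise-linear function `g_{β,γ}` equal to `0` on `(−∞, β]`,
equal to `1` on `[γ, ∞)`, and linear on `[β, γ]`. -/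
noncomputable def gfun (β γ t : ℝ) : ℝ := min 1 (max 0 ((t - β) / (γ - β)))

theorem cb_trans {a b c : A} (h1 : CuntzBelow a b) (h2 : CuntzBelow b c) : CuntzBelow a c := by
  obtain ⟨v, hv⟩ := h1
  obtain ⟨w, hw⟩ := h2
  have key : ∀ n : ℕ, ∃ x : A, ‖x * c * star x - a‖ < 1 / ((n : ℝ) + 1) := by
    intro n
    have hn : (0 : ℝ) < 1 / ((n : ℝ) + 1) := by positivity
    obtain ⟨i, hi⟩ := (hv.eventually (gt_mem_nhds (half_pos hn))).exists
    have hw2 : Tendsto (fun j => ‖v i‖ * ‖w j * c * star (w j) - b‖ * ‖v i‖) atTop (𝓝 0) := by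
      simpa using (hw.const_mul ‖v i‖).mul_const ‖v i‖
    obtain ⟨j, hj⟩ := (hw2.eventually (gt_mem_nhds (half_pos hn))).exists
    refine ⟨v i * w j, ?_⟩
    have e : v i * w j * c * star (v i * w j) - a
        = v i * (w j * c * star (w j) - b) * star (v i) + (v i * b * star (v i) - a) := by
      simp only [star_mul, mul_sub, sub_mul, mul_assoc]; abel
    rw [e]
    have h3 : ‖v i * (w j * c * star (w j) - b) * star (v i)‖
        ≤ ‖v i‖ * ‖w j * c * star (w j) - b‖ * ‖v i‖ := by
      refine (norm_mul_le _ _).trans ?_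
      rw [norm_star]
      gcongr
      exact norm_mul_le _ _
    linarith [norm_add_le (v i * (w j * c * star (w j) - b) * star (v i))
      (v i * b * star (v i) - a)]
  choose x hx using key
  exact ⟨x, squeeze_zero (fun _ => norm_nonneg _) (fun n => (hx n).le)
    tendsto_one_div_add_atTop_nhds_zero_nat⟩

theorem cb_cfc {a : A} (ha : 0 ≤ a) (f h k : ℝ → ℝ) (hh : Continuous h)
    (hk : Continuous k) (hh0 : h 0 = 0) (hk0 : k 0 = 0) (e : ∀ t, f t = k t * h t * k t) :
    CuntzBelow (cfcₙ f a) (cfcₙ h a) := by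
  have hsa : IsSelfAdjoint a := ha.isSelfAdjoint
  refine ⟨fun _ => cfcₙ k a, ?_⟩
  have hs : star (cfcₙ k a) = cfcₙ k a := (cfcₙ_predicate k a).star_eq
  have : cfcₙ k a * cfcₙ h a * star (cfcₙ k a) = cfcₙ f a := by
    rw [hs, ← cfcₙ_mul k h a hk.continuousOn hk0 hh.continuousOn hh0,
      ← cfcₙ_mul (fun t => k t * h t) k a (hk.mul hh).continuousOn (by simp [hk0]) hk.continuousOn hk0]
    congr 1
    funext t
    exact (e t).symm
  simp [this]

noncomputable def gm (m : ℕ) : ℝ → ℝ := gfun ((2 : ℝ) ^ (m + 1))⁻¹ ((2 : ℝ) ^ m)⁻¹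

theorem gm_cont (m : ℕ) : Continuous (gm m) := by
  unfold gm gfun
  fun_prop

theorem gm_bd (m : ℕ) : ((2 : ℝ) ^ (m + 1))⁻¹ < ((2 : ℝ) ^ m)⁻¹ := by
  apply inv_strictAnti₀ (by positivity)
  exact pow_lt_pow_right₀ (by norm_num) (by omega)

theorem gm_low (m : ℕ) {t : ℝ} (ht : t ≤ ((2 : ℝ) ^ (m + 1))⁻¹) : gm m t = 0 := by
  have := gm_bd m
  have h : (t - ((2 : ℝ) ^ (m + 1))⁻¹) / (((2 : ℝ) ^ m)⁻¹ - ((2 : ℝ) ^ (m + 1))⁻¹) ≤ 0 :=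
    div_nonpos_of_nonpos_of_nonneg (by linarith) (by linarith)
  simp [gm, gfun, max_eq_left h]

theorem gm_zero (m : ℕ) : gm m 0 = 0 := gm_low m (by positivity)

theorem gm_high (m : ℕ) {t : ℝ} (ht : ((2 : ℝ) ^ m)⁻¹ ≤ t) : gm m t = 1 := by
  have := gm_bd m
  have h : 1 ≤ (t - ((2 : ℝ) ^ (m + 1))⁻¹) / (((2 : ℝ) ^ m)⁻¹ - ((2 : ℝ) ^ (m + 1))⁻¹) := by
    rw [le_div_iff₀ (by linarith)]; linarith
  simp only [gm, gfun]
  exact min_eq_left (h.trans (le_max_right _ _))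

theorem gm_nonneg (m : ℕ) (t : ℝ) : 0 ≤ gm m t := le_min zero_le_one (le_max_left _ _)

theorem gm_le (m : ℕ) (t : ℝ) : gm m t ≤ 1 := min_le_left _ _

theorem gm_norm (m : ℕ) (a : A) : ‖cfcₙ (gm m) a‖ ≤ 1 := by
  refine norm_cfcₙ_le fun t _ => ?_
  rw [Real.norm_of_nonneg (gm_nonneg m t)]
  exact gm_le m t

theorem cb_gm_self {a : A} (ha : 0 ≤ a) (m : ℕ) : CuntzBelow (cfcₙ (gm m) a) a := by
  have hsa : IsSelfAdjoint a := ha.isSelfAdjoint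
  have hp : (0 : ℝ) < ((2 : ℝ) ^ (m + 1))⁻¹ := by positivity
  have := cb_cfc ha (gm m) id (fun t => √(gm m t / max t ((2 : ℝ) ^ (m + 1))⁻¹)) continuous_id
    (Real.continuous_sqrt.comp ((gm_cont m).div (by fun_prop)
      (fun t => (lt_max_of_lt_right hp).ne'))) rfl (by simp [gm_zero]) (fun t => by
      rcases le_total t ((2 : ℝ) ^ (m + 1))⁻¹ with h | h
      · simp [gm_low m h]
      · have ht : 0 < t := hp.trans_le h
        have h1 : 0 ≤ gm m t / t := div_nonneg (gm_nonneg m t) ht.le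
        simp only [max_eq_left h, id]
        rw [mul_right_comm, Real.mul_self_sqrt h1]
        field_simp)
  rwa [cfcₙ_id ℝ a] at this

theorem cb_cut_gm {a : A} (ha : 0 ≤ a) {m : ℕ} {ε : ℝ} (h : ((2 : ℝ) ^ m)⁻¹ ≤ ε) :
    CuntzBelow (cutP a ε) (cfcₙ (gm m) a) := by
  have hε : 0 < ε := lt_of_lt_of_le (by positivity) h
  refine cb_cfc ha _ _ (fun t => √(max (t - ε) 0)) (gm_cont m) (by fun_prop) (gm_zero m)
    (by simp [hε.le]) (fun t => ?_)
  rcases le_total t ε with h' | h'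
  · simp [h']
  · rw [gm_high m (h.trans h'), mul_one, Real.mul_self_sqrt (le_max_right _ _)]

theorem cb_cut_cut {a : A} (ha : 0 ≤ a) {m : ℕ} {ε : ℝ} (h : ((2 : ℝ) ^ m)⁻¹ ≤ ε) :
    CuntzBelow (cutP a ε) (cutP (cfcₙ (gm m) a) (1 / 2)) := by
  have hsa : IsSelfAdjoint a := ha.isSelfAdjoint
  have hε : 0 < ε := lt_of_lt_of_le (by positivity) h
  have e : cutP (cfcₙ (gm m) a) (1 / 2) = cfcₙ (fun t => max (gm m t - 1 / 2) 0) a := by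
    unfold cutP
    rw [← cfcₙ_comp' (fun t : ℝ => max (t - 1 / 2) 0) (gm m) a (by fun_prop) (by norm_num)
      (gm_cont m).continuousOn (gm_zero m)]
  rw [e]
  have := gm_cont m
  refine cb_cfc ha _ _ (fun t => √(2 * max (t - ε) 0)) (by fun_prop) (by fun_prop)
    (by norm_num [gm_zero]) (by simp [hε.le]) (fun t => ?_)
  rcases le_total t ε with h' | h'
  · simp [h']
  · rw [gm_high m (h.trans h'), mul_right_comm, Real.mul_self_sqrt (by positivity)]
    norm_num
    ring

/-- one step -/
theorem crow_step {a b : A} (ha : 0 ≤ a) (hb : 0 ≤ b) {ε : ℝ} (hab : CuntzBelow a (cutP b ε))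
    (k : ℕ) {m : ℕ} (hm : ((2 : ℝ) ^ m)⁻¹ ≤ ε) {η : ℝ} (hη : 0 < η) :
    ∃ v : A, ‖v‖ ≤ 1 ∧ cfcₙ (gm m) b * star v = star v ∧
      ‖v * star v * cfcₙ (gm k) a - cfcₙ (gm k) a‖ < η := by
  have hsa : IsSelfAdjoint a := ha.isSelfAdjoint
  have hsb : IsSelfAdjoint b := hb.isSelfAdjoint
  have hε : 0 < ε := lt_of_lt_of_le (by positivity) hm
  set c := cfcₙ (gm k) a with hc
  set e := cfcₙ (gm (k + 1)) a with he
  have hec : e * c = c := by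
    rw [hc, he, ← cfcₙ_mul _ _ a (gm_cont _).continuousOn (gm_zero _) (gm_cont _).continuousOn
      (gm_zero _)]
    congr 1
    funext t
    rcases le_total t ((2 : ℝ) ^ (k + 1))⁻¹ with h | h
    · simp [gm_low k h]
    · simp [gm_high (k + 1) h]
  obtain ⟨x, hx⟩ := cb_trans (cb_gm_self ha (k + 1)) hab
  obtain ⟨i, hi⟩ := (hx.eventually (gt_mem_nhds (half_pos hη))).exists
  set s := cfcₙ (fun t => √(max (t - ε) 0)) b with hs
  have hss : star s = s := IsSelfAdjoint.star_eq (cfcₙ_predicate (R := ℝ) _ b)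
  have hs2 : s * s = cutP b ε := by
    rw [hs, ← cfcₙ_mul _ _ b (by fun_prop) (by simp [hε.le]) (by fun_prop) (by simp [hε.le])]
    unfold cutP
    congr 1
    funext t
    exact Real.mul_self_sqrt (le_max_right _ _)
  have hgs : cfcₙ (gm m) b * s = s := by
    rw [hs, ← cfcₙ_mul _ _ b (gm_cont _).continuousOn (gm_zero _) (by fun_prop) (by simp [hε.le])]
    congr 1
    funext t
    rcases le_total t ε with h' | h'
    · simp [h']
    · rw [gm_high m (hm.trans h'), one_mul]
  set y := x i * s with hy
  have hyy : y * star y = x i * cutP b ε * star (x i) := by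
    rw [hy, star_mul, hss, ← hs2]; simp only [mul_assoc]
  set r : ℝ := 1 + η / 2 with hr
  have hr0 : 0 < r := by positivity
  have hze : ‖y * star y - e‖ < η / 2 := by rw [hyy]; exact hi
  have hzn : ‖y‖ * ‖y‖ ≤ r := by
    rw [← CStarRing.norm_self_mul_star]
    have h1 : ‖y * star y‖ ≤ ‖y * star y - e‖ + ‖e‖ := by
      simpa using norm_add_le (y * star y - e) e
    have h2 : ‖e‖ ≤ 1 := gm_norm (k + 1) a
    linarith
  refine ⟨(√r)⁻¹ • y, ?_, ?_, ?_⟩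
  · rw [norm_smul, norm_inv, Real.norm_of_nonneg (Real.sqrt_nonneg _), inv_mul_le_iff₀
      (Real.sqrt_pos.2 hr0), mul_one]
    exact Real.le_sqrt_of_sq_le (by rw [sq]; exact hzn)
  · rw [star_smul, mul_smul_comm, hy, star_mul, hss, ← mul_assoc, hgs]
  · have e1 : ((√r)⁻¹ • y) * star ((√r)⁻¹ • y) * c - c
        = r⁻¹ • ((y * star y - e) * c - (η / 2) • c) := by
      rw [star_smul, smul_mul_smul_comm, star_trivial, ← mul_inv, Real.mul_self_sqrt hr0.le,
        sub_mul, hec, smul_mul_assoc]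
      have : c = r⁻¹ • (c + (η / 2) • c) := by
        rw [eq_inv_smul_iff₀ hr0.ne', hr, add_smul, one_smul]
      nth_rewrite 2 [this]
      rw [← smul_sub]
      congr 1
      abel
    rw [e1, norm_smul, norm_inv, Real.norm_of_nonneg hr0.le, inv_mul_lt_iff₀ hr0]
    have hcn : ‖c‖ ≤ 1 := gm_norm k a
    have h1 : ‖(y * star y - e) * c‖ ≤ ‖y * star y - e‖ := 
      (norm_mul_le _ _).trans (mul_le_of_le_one_right (norm_nonneg _) hcn)
    have h2 : ‖(η / 2) • c‖ ≤ η / 2 := by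
      rw [norm_smul, Real.norm_of_nonneg (by positivity)]
      exact mul_le_of_le_one_right (by positivity) hcn
    have h3 := norm_sub_le ((y * star y - e) * c) ((η / 2) • c)
    have h4 : η ≤ r * η := by rw [hr]; nlinarith
    linarith

theorem stmt6 (a : ℕ → A) (hpos : ∀ n, 0 ≤ a n) (hnorm : ∀ n, ‖a n‖ ≤ 1)
    (hri : RapidlyIncreasing a) :
    ∃ m : ℕ → ℕ,
      VeryRapidlyIncreasing
        (fun n => cfcₙ (gfun ((2 : ℝ) ^ (m n + 1))⁻¹ ((2 : ℝ) ^ (m n))⁻¹) (a n)) ∧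
      (∀ n, CuntzBelow
        (cfcₙ (gfun ((2 : ℝ) ^ (m n + 1))⁻¹ ((2 : ℝ) ^ (m n))⁻¹) (a n)) (a n)) ∧
      (∀ n, CuntzBelow (a n)
        (cfcₙ (gfun ((2 : ℝ) ^ (m (n + 1) + 1))⁻¹ ((2 : ℝ) ^ (m (n + 1)))⁻¹) (a (n + 1)))) := by
  choose ε hε hcb using hri
  have hM : ∀ n, ∃ M : ℕ, ((2 : ℝ) ^ M)⁻¹ ≤ ε n := by
    intro n
    obtain ⟨M, hM⟩ := exists_pow_lt_of_lt_one (hε n) (by norm_num : (2 : ℝ)⁻¹ < 1)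
    exact ⟨M, by rw [← inv_pow]; exact hM.le⟩
  choose M hM using hM
  let m : ℕ → ℕ := fun n => Nat.casesOn n 0 M
  have hm : ∀ n, ((2 : ℝ) ^ (m (n + 1)))⁻¹ ≤ ε n := hM
  refine ⟨m, ⟨?_, ?_⟩, fun n => cb_gm_self (hpos n) (m n),
    fun n => cb_trans (hcb n) (cb_cut_gm (hpos (n + 1)) (hm n))⟩
  · intro n
    exact ⟨1 / 2, by norm_num, cb_trans (cb_gm_self (hpos n) (m n))
      (cb_trans (hcb n) (cb_cut_cut (hpos (n + 1)) (hm n)))⟩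
  · have main : ∀ n d : ℕ, ∀ η > (0 : ℝ), ∃ v : A, ‖v‖ ≤ 1 ∧
        cfcₙ (gm (m (n + 1 + d))) (a (n + 1 + d)) * star v = star v ∧
        ‖v * star v * cfcₙ (gm (m n)) (a n) - cfcₙ (gm (m n)) (a n)‖ < η := by
      intro n d
      induction d with
      | zero =>
        intro η hη
        exact crow_step (hpos n) (hpos (n + 1)) (hcb n) (m n) (hm n) hη
      | succ d ih =>
        intro η hη
        obtain ⟨v, hv1, hv2, hv3⟩ := ih (η / 2) (half_pos hη)
        obtain ⟨w, hw1, hw2, hw3⟩ := crow_step (hpos (n + 1 + d)) (hpos (n + 1 + d + 1))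
          (hcb (n + 1 + d)) (m (n + 1 + d)) (hm (n + 1 + d)) (half_pos hη)
        set c := cfcₙ (gm (m n)) (a n)
        set c' := cfcₙ (gm (m (n + 1 + d))) (a (n + 1 + d))
        have hc : ‖c‖ ≤ 1 := gm_norm _ _
        refine ⟨v * w, (norm_mul_le _ _).trans (mul_le_one₀ hv1 (norm_nonneg _) hw1), ?_, ?_⟩
        · rw [star_mul, ← mul_assoc]
          exact congrArg (· * star v) hw2
        · have e : v * w * star (v * w) * c - c
              = v * (w * star w * c' - c') * (star v * c) + (v * star v * c - c) := by
            have e1 : v * (w * star w * c' - c') * (star v * c)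
                = v * (w * star w) * (c' * star v) * c - v * (c' * star v) * c := by
              simp only [mul_sub, sub_mul, mul_assoc]
            rw [e1, hv2, star_mul]
            simp only [mul_assoc]
            abel
          rw [e]
          have h1 : ‖v * (w * star w * c' - c') * (star v * c)‖ ≤ ‖w * star w * c' - c'‖ := by
            have h2 : ‖star v * c‖ ≤ 1 := (norm_mul_le _ _).trans
              (mul_le_one₀ (by rwa [norm_star]) (norm_nonneg _) hc)
            refine (norm_mul_le _ _).trans ((mul_le_of_le_one_right (norm_nonneg _) h2).trans ?_)
            exact (norm_mul_le _ _).trans (mul_le_of_le_one_left (norm_nonneg _) hv1)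
          linarith [norm_add_le (v * (w * star w * c' - c') * (star v * c)) (v * star v * c - c)]
    intro η hη n
    refine ⟨n + 1, fun k hk => ?_⟩
    obtain ⟨d, rfl⟩ := Nat.exists_eq_add_of_le hk
    obtain ⟨v, hv1, hv2, hv3⟩ := main n d η hη
    refine ⟨v, hv1, ?_⟩
    change ‖v * cfcₙ (gm (m (n + 1 + d))) (a (n + 1 + d)) * star v * cfcₙ (gm (m n)) (a n)
      - cfcₙ (gm (m n)) (a n)‖ < η
    rw [mul_assoc v, hv2]
    exact hv3
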